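/- arXiv:2106.06755 — 5 statements merged into one kernel-verified Lean document; each statement's English description precedes it below -/
import Mathlib

section
/- Let (X, d) be a metric space, let S ⊆ X be a finite set with weight function w : S → ℝ_{≥0}, let z ≥ 1 be real, and let A, B ⊆ X be nonempty finite sets. For each a ∈ A choose f(a) ∈ B with d(a, f(a)) = min_{b ∈ B} d(a, b), and let f(A) = { f(a) : a ∈ A }. Then cost(f(A), S) ≤ 3^(z-1) · (2 · cost(A, S) + cost(B, S)), where cost(C, S) = Σ_{p ∈ S} (min_{c ∈ C} d(c,p))^z · w(p). -/
/-- Unconstrained clustering cost of a weighted finite set `S` with respect to a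
finite center set `C`: `cost(C, S) = Σ_{p ∈ S} (min_{c ∈ C} d(c,p))^z · w(p)`. -/
noncomputable def cost {X : Type*} [MetricSpace X] (z : ℝ) (C S : Finset X)
    (w : X → ℝ) : ℝ :=
  ∑ p ∈ S, Metric.infDist p (C : Set X) ^ z * w p

/-- Power-mean bound for a sum of three terms, two of which agree. -/
lemma Real.two_mul_add_rpow_le {x y z : ℝ} (hx : 0 ≤ x) (hy : 0 ≤ y) (hz : 1 ≤ z) :
    (2 * x + y) ^ z ≤ 3 ^ (z - 1) * (2 * x ^ z + y ^ z) := by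
  have h := Real.rpow_sum_le_const_mul_sum_rpow_of_nonneg (f := ![x, x, y]) Finset.univ hz
    (by intro i _; fin_cases i <;> simpa)
  simpa [Fin.sum_univ_three, two_mul] using h

/-- Projecting the centers `A` onto nearest points of `B` at most doubles the distance to `A`,
up to adding the distance to `B`. -/
lemma Metric.infDist_image_le_two_mul_infDist_add {X : Type*} [PseudoMetricSpace X]
    {A B : Set X} (hA : IsCompact A) (hne : A.Nonempty) {f : X → X}
    (hf : ∀ a ∈ A, dist a (f a) = Metric.infDist a B) (p : X) :
    Metric.infDist p (f '' A) ≤ 2 * Metric.infDist p A + Metric.infDist p B := by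
  obtain ⟨a, ha, hpa⟩ := hA.exists_infDist_eq_dist hne p
  calc Metric.infDist p (f '' A) ≤ dist p (f a) :=
        Metric.infDist_le_dist_of_mem (Set.mem_image_of_mem f ha)
    _ ≤ dist p a + dist a (f a) := dist_triangle _ _ _
    _ ≤ dist p a + (Metric.infDist p B + dist a p) := by
        rw [hf a ha]
        gcongr
        exact Metric.infDist_le_infDist_add_dist
    _ = 2 * Metric.infDist p A + Metric.infDist p B := by
        rw [hpa, dist_comm a p]
        ring

/-- Projection inequality from Lemma 3 of the paper: if `f(a)` is a nearest point
of `B` to `a` for each `a ∈ A`, then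
`cost(f(A), S) ≤ 3^(z-1) · (2 · cost(A, S) + cost(B, S))`. -/
theorem projection_cost_bound {X : Type*} [MetricSpace X] [DecidableEq X]
    (z : ℝ) (hz : 1 ≤ z)
    (S : Finset X) (w : X → ℝ) (hw : ∀ p ∈ S, 0 ≤ w p)
    (A B : Finset X) (hA : A.Nonempty) (hB : B.Nonempty)
    (f : X → X) (hfB : ∀ a ∈ A, f a ∈ B)
    (hf : ∀ a ∈ A, dist a (f a) = Metric.infDist a (B : Set X)) :
    cost z (A.image f) S w ≤ 3 ^ (z - 1) * (2 * cost z A S w + cost z B S w) := by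
  unfold cost
  rw [Finset.mul_sum, ← Finset.sum_add_distrib, Finset.mul_sum]
  refine Finset.sum_le_sum fun p hp => ?_
  have hdist := Metric.infDist_image_le_two_mul_infDist_add A.finite_toSet.isCompact hA hf p
  rw [← Finset.coe_image] at hdist
  calc Metric.infDist p (A.image f : Set X) ^ z * w p
      ≤ 3 ^ (z - 1) * (2 * Metric.infDist p (A : Set X) ^ z
          + Metric.infDist p (B : Set X) ^ z) * w p :=
        mul_le_mul_of_nonneg_right
          ((Real.rpow_le_rpow Metric.infDist_nonneg hdist (by linarith)).trans
            (Real.two_mul_add_rpow_le Metric.infDist_nonneg Metric.infDist_nonneg hz)) (hw p hp)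
    _ = _ := by ring
end

section
/- Let (X, d) be a metric space, let P ⊆ X be a finite set partitioned into groups P_1, …, P_ℓ with weight functions w_j : P_j → ℝ_{>0}, let F ⊆ X be finite with |F| ≥ k, let z ≥ 1 be real, and let c ≥ 1. Define OPT_u and OPT as the minima over k-element subsets C' ⊆ F of the unconstrained cost cost(C', P) and of the fair cost Φ(C', P) = max_j cost(C', P_j), respectively. If C ⊆ F is a nonempty set with cost(C, P) ≤ c · OPT_u, then Φ(C, P) ≤ c · ℓ · OPT. -/
/-- Unconstrained cost of the whole point set: the sum of the costs of all groups. -/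
noncomputable def ucost {X : Type*} [MetricSpace X] (z : ℝ) {ℓ : ℕ}
    (C : Finset X) (Pj : Fin ℓ → Finset X) (w : Fin ℓ → X → ℝ) : ℝ :=
  ∑ j, cost z C (Pj j) (w j)

/-- Fair clustering cost: `Φ(C, P) = max_{j ∈ [ℓ]} cost(C, P_j)`. -/
noncomputable def fairCost {X : Type*} [MetricSpace X] (z : ℝ) {ℓ : ℕ}
    (C : Finset X) (Pj : Fin ℓ → Finset X) (w : Fin ℓ → X → ℝ) : ℝ :=
  ⨆ j, cost z C (Pj j) (w j)

theorem cost_nonneg {X : Type*} [MetricSpace X] (z : ℝ) (C : Finset X) {S : Finset X}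
    {w : X → ℝ} (hw : ∀ p ∈ S, 0 ≤ w p) : 0 ≤ cost z C S w :=
  Finset.sum_nonneg fun p hp =>
    mul_nonneg (Real.rpow_nonneg Metric.infDist_nonneg z) (hw p hp)

/-- The fair cost is at most the unconstrained cost. -/
theorem fairCost_le_ucost {X : Type*} [MetricSpace X] (z : ℝ) {ℓ : ℕ} (C : Finset X)
    {Pj : Fin ℓ → Finset X} {w : Fin ℓ → X → ℝ} (hw : ∀ j, ∀ p ∈ Pj j, 0 ≤ w j p) :
    fairCost z C Pj w ≤ ucost z C Pj w :=
  Real.iSup_le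
    (fun j => Finset.single_le_sum (f := fun j => cost z C (Pj j) (w j))
      (fun i _ => cost_nonneg z C (hw i)) (Finset.mem_univ j))
    (Finset.sum_nonneg fun i _ => cost_nonneg z C (hw i))

/-- The unconstrained cost is at most the number of groups times the fair cost. -/
theorem ucost_le_mul_fairCost {X : Type*} [MetricSpace X] (z : ℝ) {ℓ : ℕ} (C : Finset X)
    (Pj : Fin ℓ → Finset X) (w : Fin ℓ → X → ℝ) :
    ucost z C Pj w ≤ ℓ * fairCost z C Pj w := by
  have h := Finset.sum_le_card_nsmul Finset.univ (fun j => cost z C (Pj j) (w j))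
    (fairCost z C Pj w) fun j _ =>
      le_ciSup (f := fun j => cost z C (Pj j) (w j)) (Set.finite_range _).bddAbove j
  simpa [ucost] using h

/-- Appendix C of the paper: any `c`-approximation to the unconstrained clustering
objective is a `(c·ℓ)`-approximation to the socially fair objective. -/
theorem unconstrained_approx_is_fair_approx {X : Type*} [MetricSpace X] {ℓ k : ℕ}
    (hℓ : 0 < ℓ)
    (P F : Finset X) (Pj : Fin ℓ → Finset X) (w : Fin ℓ → X → ℝ)
    (hPart : ∀ p ∈ P, ∃! j, p ∈ Pj j) (hSub : ∀ j, Pj j ⊆ P)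
    (hw : ∀ j, ∀ p ∈ Pj j, 0 < w j p)
    (hkF : k ≤ F.card) (z : ℝ) (hz : 1 ≤ z)
    (c : ℝ) (hc : 1 ≤ c)
    (OPTu OPT : ℝ)
    (hOPTu : IsLeast {v : ℝ | ∃ C' : Finset X, C' ⊆ F ∧ C'.card = k ∧
      ucost z C' Pj w = v} OPTu)
    (hOPT : IsLeast {v : ℝ | ∃ C' : Finset X, C' ⊆ F ∧ C'.card = k ∧
      fairCost z C' Pj w = v} OPT)
    (C : Finset X) (hCF : C ⊆ F) (hCne : C.Nonempty)
    (hC : ucost z C Pj w ≤ c * OPTu) :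
    fairCost z C Pj w ≤ c * ℓ * OPT := by
  obtain ⟨C', hC'F, hC'k, rfl⟩ := hOPT.1
  calc fairCost z C Pj w ≤ ucost z C Pj w :=
        fairCost_le_ucost z C fun j p hp => (hw j p hp).le
    _ ≤ c * OPTu := hC
    _ ≤ c * (ℓ * fairCost z C' Pj w) := by
        gcongr
        exact (hOPTu.2 ⟨C', hC'F, hC'k, rfl⟩).trans (ucost_le_mul_fairCost z C' Pj w)
    _ = c * ℓ * fairCost z C' Pj w := (mul_assoc _ _ _).symm
end

section
/- Let (X, d) be a metric space, let P ⊆ X be a finite set partitioned into groups P_1, …, P_ℓ with weight functions w_j : P_j → ℝ_{>0}, let F ⊆ X be finite with |F| ≥ k, let z ≥ 1 be real, let OPT = min over C'' ⊆ F with |C''| = k of Φ(C'', P), and let 0 < ε ≤ 1. If C ⊆ F is a nonempty set with Φ(C, P) ≤ (1 + ε/3^(z-1)) · OPT, then there exists C' ⊆ C with |C'| ≤ k and Φ(C', P) ≤ (3^z + ε) · OPT. -/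
/-- Weighted power-mean inequality for the three summands `a, a, b`. -/
lemma two_mul_add_rpow_le {a b z : ℝ} (ha : 0 ≤ a) (hb : 0 ≤ b) (hz : 1 ≤ z) :
    (2 * a + b) ^ z ≤ 3 ^ (z - 1) * (2 * a ^ z + b ^ z) := by
  have hconv := (convexOn_rpow hz).2 (Set.mem_Ici.2 ha) (Set.mem_Ici.2 hb)
    (by norm_num : (0 : ℝ) ≤ 2 / 3) (by norm_num : (0 : ℝ) ≤ 1 / 3) (by norm_num)
  simp only [smul_eq_mul] at hconv
  have hsplit : 2 * a + b = 3 * (2 / 3 * a + 1 / 3 * b) := by ring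
  have hthree : (3 : ℝ) ^ z = 3 ^ (z - 1) * 3 := by
    rw [← Real.rpow_add_one (by norm_num), sub_add_cancel]
  calc (2 * a + b) ^ z = 3 ^ z * (2 / 3 * a + 1 / 3 * b) ^ z := by
        rw [hsplit, Real.mul_rpow (by norm_num) (by positivity)]
    _ ≤ 3 ^ z * (2 / 3 * a ^ z + 1 / 3 * b ^ z) := by gcongr
    _ = 3 ^ (z - 1) * (2 * a ^ z + b ^ z) := by rw [hthree]; ring

lemma Finset.exists_mem_infDist_eq_dist {X : Type*} [MetricSpace X] {C : Finset X}
    (hC : C.Nonempty) (p : X) : ∃ c ∈ C, Metric.infDist p (C : Set X) = dist p c := by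
  obtain ⟨c, hc, h⟩ :=
    C.finite_toSet.isCompact.exists_infDist_eq_dist (Finset.coe_nonempty.2 hC) p
  exact ⟨c, Finset.mem_coe.1 hc, h⟩

/-- Projecting a center set `D` onto its nearest points in `C` gives at most `#D` centers in `C`,
at distance at most `2 d(p, D) + d(p, C)` from every point `p`. -/
lemma exists_subset_infDist_le {X : Type*} [MetricSpace X] {C : Finset X} (hC : C.Nonempty)
    (D : Finset X) :
    ∃ C' ⊆ C, C'.card ≤ D.card ∧ ∀ p, Metric.infDist p (C' : Set X) ≤
      2 * Metric.infDist p (D : Set X) + Metric.infDist p (C : Set X) := by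
  classical
  choose proj hproj_mem hproj using Finset.exists_mem_infDist_eq_dist hC
  refine ⟨D.image proj, Finset.image_subset_iff.2 fun x _ => hproj_mem x,
    Finset.card_image_le, fun p => ?_⟩
  rcases D.eq_empty_or_nonempty with rfl | hD
  · simpa using Metric.infDist_nonneg
  obtain ⟨q, hqD, hq⟩ := Finset.exists_mem_infDist_eq_dist hD p
  have hmem : proj q ∈ ((D.image proj : Finset X) : Set X) :=
    Finset.mem_coe.2 (Finset.mem_image_of_mem proj hqD)
  have hle := Metric.infDist_le_dist_of_mem (x := p) hmem
  have htri := dist_triangle p q (proj q)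
  have hlip := Metric.infDist_le_infDist_add_dist (s := (C : Set X)) (x := q) (y := p)
  rw [hproj q, dist_comm q p] at hlip
  linarith

lemma cost_le_fairCost {X : Type*} [MetricSpace X] (z : ℝ) {ℓ : ℕ} (C : Finset X)
    (Pj : Fin ℓ → Finset X) (w : Fin ℓ → X → ℝ) (j : Fin ℓ) :
    cost z C (Pj j) (w j) ≤ fairCost z C Pj w :=
  le_ciSup (f := fun j => cost z C (Pj j) (w j)) (Set.finite_range _).bddAbove j

lemma cost_le_of_infDist_le {X : Type*} [MetricSpace X] {z : ℝ} (hz : 1 ≤ z)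
    {C C' D S : Finset X} {w : X → ℝ} (hw : ∀ p ∈ S, 0 ≤ w p)
    (h : ∀ p, Metric.infDist p (C' : Set X) ≤
      2 * Metric.infDist p (D : Set X) + Metric.infDist p (C : Set X)) :
    cost z C' S w ≤ 3 ^ (z - 1) * (2 * cost z D S w + cost z C S w) := by
  simp only [cost, Finset.mul_sum, ← Finset.sum_add_distrib]
  refine Finset.sum_le_sum fun p hp => ?_
  calc Metric.infDist p (C' : Set X) ^ z * w p
      ≤ (3 ^ (z - 1) * (2 * Metric.infDist p (D : Set X) ^ z
          + Metric.infDist p (C : Set X) ^ z)) * w p := by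
        refine mul_le_mul_of_nonneg_right ?_ (hw p hp)
        exact (Real.rpow_le_rpow Metric.infDist_nonneg (h p) (by linarith)).trans
          (two_mul_add_rpow_le Metric.infDist_nonneg Metric.infDist_nonneg hz)
    _ = _ := by ring

/-- Existential content of the paper's main result (Theorem 1): any
`(1 + ε/3^(z-1))`-approximate bi-criteria center set `C ⊆ F` contains a subset
of size at most `k` with fair cost at most `(3^z + ε)·OPT`. -/
theorem main_existential {X : Type*} [MetricSpace X] {ℓ k : ℕ} (hℓ : 0 < ℓ)
    (P F : Finset X) (Pj : Fin ℓ → Finset X) (w : Fin ℓ → X → ℝ)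
    (hPart : ∀ p ∈ P, ∃! j, p ∈ Pj j) (hSub : ∀ j, Pj j ⊆ P)
    (hw : ∀ j, ∀ p ∈ Pj j, 0 < w j p)
    (hkF : k ≤ F.card) (z : ℝ) (hz : 1 ≤ z)
    (OPT : ℝ)
    (hOPT : IsLeast {v : ℝ | ∃ C'' : Finset X, C'' ⊆ F ∧ C''.card = k ∧
      fairCost z C'' Pj w = v} OPT)
    (ε : ℝ) (hε0 : 0 < ε) (hε1 : ε ≤ 1)
    (C : Finset X) (hCF : C ⊆ F) (hCne : C.Nonempty)
    (hC : fairCost z C Pj w ≤ (1 + ε / 3 ^ (z - 1)) * OPT) :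
    ∃ C' ⊆ C, C'.card ≤ k ∧ fairCost z C' Pj w ≤ (3 ^ z + ε) * OPT := by
  obtain ⟨⟨D, -, hDk, hD⟩, -⟩ := hOPT
  obtain ⟨C', hC'C, hcard, hdist⟩ := exists_subset_infDist_le hCne D
  refine ⟨C', hC'C, hcard.trans_eq hDk, ?_⟩
  have : Nonempty (Fin ℓ) := ⟨⟨0, hℓ⟩⟩
  refine ciSup_le fun j => ?_
  have hpos : (0 : ℝ) < 3 ^ (z - 1) := by positivity
  have hthree : (3 : ℝ) ^ z = 3 ^ (z - 1) * 3 := by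
    rw [← Real.rpow_add_one (by norm_num), sub_add_cancel]
  have hDj : cost z D (Pj j) (w j) ≤ OPT := (cost_le_fairCost z D Pj w j).trans_eq hD
  have hCj := (cost_le_fairCost z C Pj w j).trans hC
  calc cost z C' (Pj j) (w j)
      ≤ 3 ^ (z - 1) * (2 * cost z D (Pj j) (w j) + cost z C (Pj j) (w j)) :=
        cost_le_of_infDist_le hz (fun p hp => (hw j p hp).le) hdist
    _ ≤ 3 ^ (z - 1) * (2 * OPT + (1 + ε / 3 ^ (z - 1)) * OPT) := by gcongr
    _ = (3 ^ z + ε) * OPT := by rw [hthree]; field_simp; ring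
end

section
/- Let U be a finite set, let S_1, …, S_m ⊆ U, and let V be the disjoint union of U and the index set {1, …, m}. Define d : V × V → ℝ by: d(v, v) = 0 for all v; d(e, e') = 2 for distinct e, e' ∈ U; d(i, j) = 2 for distinct indices i, j; and for e ∈ U and index i, d(e, i) = d(i, e) = 1 if e ∈ S_i and d(e, i) = d(i, e) = 3 otherwise. Then d is a metric on V, i.e., it is nonnegative, vanishes exactly on the diagonal, is symmetric, and satisfies the triangle inequality. -/
/-- The distance function of the paper's Appendix D reduction from set coverage
to `k`-supplier, on the disjoint union of the ground set `U` and the index set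
`Fin m`: distinct points on the same side are at distance `2`; an element `e`
and an index `i` are at distance `1` if `e ∈ S i` and `3` otherwise. -/
def supplierDist {U : Type*} [DecidableEq U] {m : ℕ} (S : Fin m → Finset U) :
    U ⊕ Fin m → U ⊕ Fin m → ℝ
  | Sum.inl e, Sum.inl e' => if e = e' then 0 else 2
  | Sum.inr i, Sum.inr j => if i = j then 0 else 2
  | Sum.inl e, Sum.inr i => if e ∈ S i then 1 else 3
  | Sum.inr i, Sum.inl e => if e ∈ S i then 1 else 3

/-- The distance function of the Appendix D reduction is a metric: nonnegative,
vanishing exactly on the diagonal, symmetric, and satisfying the triangle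
inequality. -/
theorem supplierDist_is_metric {U : Type*} [Fintype U] [DecidableEq U]
    {m : ℕ} (S : Fin m → Finset U) :
    (∀ v w : U ⊕ Fin m, 0 ≤ supplierDist S v w) ∧
    (∀ v w : U ⊕ Fin m, supplierDist S v w = 0 ↔ v = w) ∧
    (∀ v w : U ⊕ Fin m, supplierDist S v w = supplierDist S w v) ∧
    (∀ u v w : U ⊕ Fin m, supplierDist S u w ≤ supplierDist S u v + supplierDist S v w) := by
  refine ⟨?_, ?_, ?_, ?_⟩
  · rintro (e | i) (e' | j) <;> simp only [supplierDist] <;> split_ifs <;> norm_num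
  · rintro (e | i) (e' | j) <;> simp only [supplierDist] <;> split_ifs <;> simp_all
  · rintro (e | i) (e' | j) <;> simp only [supplierDist, eq_comm]
  · rintro (e | i) (e' | j) (e'' | k) <;> simp only [supplierDist] <;> grind
end

section
/- Let U be a nonempty finite set, let S_1, …, S_m ⊆ U, let k ≤ m be a positive integer, and let z ≥ 1 be real. For C ⊆ {1, …, m} nonempty, define the supplier cost of C as max_{e ∈ U} (min_{i ∈ C} d(e, i))^z, where d(e, i) = 1 if e ∈ S_i and d(e, i) = 3 otherwise. Then: (a) there exist indices i_1, …, i_k with S_{i_1} ∪ ⋯ ∪ S_{i_k} = U if and only if there exists C ⊆ {1, …, m} with |C| = k and supplier cost of C equal to 1; and (b) if no k sets among S_1, …, S_m cover U, then every C ⊆ {1, …, m} with |C| = k has supplier cost equal to 3^z. -/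
/-- `k`-supplier cost of a center set `C ⊆ {1,…,m}` for the set-coverage
instance: `max_{e ∈ U} (min_{i ∈ C} d(e,i))^z`, where `d(e,i) = 1` if `e ∈ S i`
and `3` otherwise. -/
noncomputable def scost {U : Type*} [Fintype U] [DecidableEq U] {m : ℕ} (S : Fin m → Finset U)
    (z : ℝ) (C : Finset (Fin m)) : ℝ :=
  ⨆ e : U, (⨅ i : {i : Fin m // i ∈ C}, if e ∈ S (i : Fin m) then (1 : ℝ) else 3) ^ z

/-- The distance from `e` to a nonempty center set is `1` if some center covers `e`, else `3`. -/
lemma iInf_coverage_dist {U ι : Type*} [DecidableEq U] (S : ι → Finset U) {C : Finset ι}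
    (hC : C.Nonempty) (e : U) [Decidable (∃ i ∈ C, e ∈ S i)] :
    (⨅ i : {i : ι // i ∈ C}, if e ∈ S (i : ι) then (1 : ℝ) else 3) =
      if ∃ i ∈ C, e ∈ S i then 1 else 3 := by
  have : Nonempty {i : ι // i ∈ C} := hC.to_subtype
  split_ifs with h
  · obtain ⟨i, hi, hei⟩ := h
    refine le_antisymm ?_ (le_ciInf fun j => by split_ifs <;> norm_num)
    exact (ciInf_le (Set.finite_range _).bddBelow (⟨i, hi⟩ : {i : ι // i ∈ C})).trans
      (by simp [hei])
  · have hne : ∀ i : {i : ι // i ∈ C}, e ∉ S i := fun i hei => h ⟨i, i.2, hei⟩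
    simp [hne]

lemma scost_eq_one {U : Type*} [Fintype U] [DecidableEq U] [Nonempty U] {m : ℕ}
    (S : Fin m → Finset U) (z : ℝ) {C : Finset (Fin m)} (hC : C.Nonempty)
    (h : ∀ e, ∃ i ∈ C, e ∈ S i) : scost S z C = 1 := by
  classical
  simp only [scost, iInf_coverage_dist S hC, if_pos (h _), Real.one_rpow, ciSup_const]

lemma scost_eq_three_rpow {U : Type*} [Fintype U] [DecidableEq U] {m : ℕ}
    (S : Fin m → Finset U) {z : ℝ} (hz : 0 ≤ z) {C : Finset (Fin m)} (hC : C.Nonempty)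
    (h : ¬ ∀ e, ∃ i ∈ C, e ∈ S i) : scost S z C = 3 ^ z := by
  classical
  obtain ⟨e, he⟩ := not_forall.mp h
  have : Nonempty U := ⟨e⟩
  simp only [scost, iInf_coverage_dist S hC]
  refine le_antisymm (ciSup_le fun x => ?_) ?_
  · exact Real.rpow_le_rpow (by split_ifs <;> norm_num) (by split_ifs <;> norm_num) hz
  · exact le_ciSup_of_le (Set.finite_range _).bddAbove e (by rw [if_neg he])

/-- A cover by an indexed family of at most `k` sets exists iff one by exactly `k` distinct
indices does. -/
lemma exists_fin_cover_iff_exists_card_eq {U : Type*} {m k : ℕ} (S : Fin m → Finset U)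
    (hkm : k ≤ m) :
    (∃ f : Fin k → Fin m, ∀ e : U, ∃ j : Fin k, e ∈ S (f j)) ↔
      ∃ C : Finset (Fin m), C.card = k ∧ ∀ e, ∃ i ∈ C, e ∈ S i := by
  constructor
  · rintro ⟨f, hf⟩
    obtain ⟨C, hfC, hC⟩ := Finset.exists_superset_card_eq (s := Finset.univ.image f) (n := k)
      (Finset.card_image_le.trans (by simp)) (by simpa using hkm)
    refine ⟨C, hC, fun e => ?_⟩
    obtain ⟨j, hj⟩ := hf e
    exact ⟨f j, hfC (Finset.mem_image_of_mem f (Finset.mem_univ j)), hj⟩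
  · rintro ⟨C, hC, h⟩
    refine ⟨fun j => (C.equivFinOfCardEq hC).symm j, fun e => ?_⟩
    obtain ⟨i, hi, hei⟩ := h e
    exact ⟨C.equivFinOfCardEq hC ⟨i, hi⟩, by simpa using hei⟩

/-- Gap property of the Appendix D reduction from set coverage to `k`-supplier:
(a) some `k` sets among `S_1, …, S_m` cover `U` iff some `k`-element center set
has supplier cost `1`; (b) if no `k` sets cover `U`, every `k`-element center
set has supplier cost `3^z`. -/
theorem set_coverage_supplier_gap {U : Type*} [Fintype U] [DecidableEq U] [Nonempty U]
    {m k : ℕ} (S : Fin m → Finset U) (hk0 : 0 < k) (hkm : k ≤ m)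
    (z : ℝ) (hz : 1 ≤ z) :
    ((∃ f : Fin k → Fin m, ∀ e : U, ∃ j : Fin k, e ∈ S (f j)) ↔
      (∃ C : Finset (Fin m), C.card = k ∧ scost S z C = 1)) ∧
    ((¬ ∃ f : Fin k → Fin m, ∀ e : U, ∃ j : Fin k, e ∈ S (f j)) →
      ∀ C : Finset (Fin m), C.card = k → scost S z C = 3 ^ z) := by
  rw [exists_fin_cover_iff_exists_card_eq S hkm]
  have hne : ∀ C : Finset (Fin m), C.card = k → C.Nonempty := fun C hC =>
    Finset.card_pos.mp (hC ▸ hk0)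
  have hz0 : 0 < z := by linarith
  refine ⟨exists_congr fun C => and_congr_right fun hC =>
    ⟨scost_eq_one S z (hne C hC), fun hcost => ?_⟩, fun hno C hC =>
      scost_eq_three_rpow S hz0.le (hne C hC) fun h => hno ⟨C, hC, h⟩⟩
  by_contra h
  rw [scost_eq_three_rpow S hz0.le (hne C hC) h] at hcost
  exact (Real.one_lt_rpow (by norm_num) hz0).ne' hcost
end
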